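/- Let G be a group satisfying hypothesis (H*). Let t ∈ G have order 4 and let x ∈ G have order 9 with t^2 * x * t^(-2) = x⁻¹. Then x commutes with t * x * t⁻¹; moreover, writing P = ⟨x, t * x * t⁻¹⟩, the subgroup P is commutative, every element p of P satisfies p^9 = 1, P is normal in H = ⟨t, x⟩, P ⊓ ⟨t⟩ = ⊥, P ⊔ ⟨t⟩ = H, and for every p ∈ P with p ≠ 1 and every k ∈ {1,2,3} one has t^k * p * t^(-k) ≠ p (so H is a Frobenius group with kernel P and complement ⟨t⟩). -/

import Mathlib

/-- A group `K` is a locally cyclic 2-group: every element has order a power of 2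
and every finitely generated subgroup is cyclic. -/
def IsLocallyCyclic2Group (K : Type*) [Group K] : Prop :=
  (∀ k : K, ∃ n : ℕ, orderOf k = 2 ^ n) ∧
  ∀ S : Subgroup K, S.FG → IsCyclic S

/-- Hypothesis (H): `G` is periodic, `π(G) = {2, 3}`, and the order of the product of
any two elements of order at most 4 does not exceed 9. -/
def HypH (G : Type*) [Group G] : Prop :=
  (∀ g : G, IsOfFinOrder g) ∧
  (∀ p : ℕ, p.Prime → ((∃ g : G, p ∣ orderOf g) ↔ p = 2 ∨ p = 3)) ∧
  ∀ x y : G, orderOf x ≤ 4 → orderOf y ≤ 4 → orderOf (x * y) ≤ 9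

/-- Hypothesis (H*): `G` satisfies (H) and the centralizer of every involution of `G`
is a locally cyclic 2-group. -/
def HypHStar (G : Type*) [Group G] : Prop :=
  HypH G ∧ ∀ a : G, a ≠ 1 → a ^ 2 = 1 →
    IsLocallyCyclic2Group (Subgroup.centralizer {a})

set_option maxHeartbeats 1000000 in
/-- Coset enumeration: the relations `t^4 = b^2 = (t^2 b)^3 = (t b)^9 = [t, b]^9 = 1` force the
coset of `⟨t⟩` to be fixed by `b`. -/
theorem collapse {Ω : Type*} (f g b : Ω → Ω) (c : Ω)
    (hfg : ∀ w, f (g w) = w) (hgf : ∀ w, g (f w) = w) (hff : ∀ w, f (f (f (f w))) = w)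
    (hb : ∀ w, b (b w) = w)
    (h3 : ∀ w, f (f (b (f (f (b (f (f (b w)))))))) = w)
    (h9 : ∀ w, (fun v => b (f v))^[9] w = w)
    (hc : ∀ w, (fun v => b (f (b (g v))))^[9] w = w)
    (h0 : f c = c) : b c = c := by
  simp only [Function.iterate_succ, Function.iterate_zero, Function.comp, id] at h9 hc
  have L3bffbffbff : ∀ w, b w = g (g (b (g (g (b (g (g w))))))) := by
    intro w
    have h := congrArg (fun v => g (g (b (g (g (b (g (g v)))))))) (h3 (w))
    simpa only [hfg, hgf, hb] using h
  have L3fbffbffbf : ∀ w, f w = b (g (g (b (g (g (b (g w))))))) := by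
    intro w
    have h := congrArg (fun v => b (g (g (b (g (g (b (g (f (b v)))))))))) (h3 (b (g w)))
    simpa only [hfg, hgf, hb] using h
  have L3ffbffbffb : ∀ w, f w = g (b (g (g (b (g (g (b w))))))) := by
    intro w
    have h := congrArg (fun v => g (b (g (g (b (g (g (b (b v))))))))) (h3 (b w))
    simpa only [hfg, hgf, hb] using h
  have L4f : ∀ w, f w = g (g (g w)) := by
    intro w
    have h := congrArg (fun v => g (g (g v))) (hff (w))
    simpa only [hfg, hgf, hb] using h
  have L9bf : ∀ w, b w = g (b (g (b (g (b (g (b (g (b (g (b (g (b (g (b (g w)))))))))))))))) := by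
    intro w
    have h := congrArg (fun v => g (b (g (b (g (b (g (b (g (b (g (b (g (b (g (b (g (f v)))))))))))))))))) (h9 (g w))
    simpa only [hfg, hgf, hb] using h
  have L9fb : ∀ w, f w = b (g (b (g (b (g (b (g (b (g (b (g (b (g (b (g (b w)))))))))))))))) := by
    intro w
    have h := congrArg (fun v => b (g (b (g (b (g (b (g (b (g (b (g (b (g (b (g (b v))))))))))))))))) (h9 (w))
    simpa only [hfg, hgf, hb] using h
  have Lcfbgb : ∀ w, f w = b (f (b (g (b (f (b (g (b (f (b (g (b (f (b (g (b (f (b (g (b (f (b (g (b (f (b (g (b (f (b (g (b (f (b w)))))))))))))))))))))))))))))))))) := by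
    intro w
    have h := congrArg (fun v => f (g v)) (hc (f w))
    simpa only [hfg, hgf, hb] using h.symm
  have Lcgbfb : ∀ w, g w = b (g (b (f (b (g (b (f (b (g (b (f (b (g (b (f (b (g (b (f (b (g (b (f (b (g (b (f (b (g (b (f (b (g (b w)))))))))))))))))))))))))))))))))) := by
    intro w
    have h := congrArg (fun v => b (g (b (f (b (g (b (f (b (g (b (f (b (g (b (f (b (g (b (f (b (g (b (f (b (g (b (f (b (g (b (f (b (g (b v))))))))))))))))))))))))))))))))))) (hc (w))
    simpa only [hfg, hgf, hb] using h
  have e0 : g c = c := by have := hgf c; rwa [h0] at this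
  obtain ⟨c1, e1⟩ : ∃ w, b c = w := ⟨_, rfl⟩
  have e2 : b c1 = c := by rw [← e1, hb]
  obtain ⟨c2, e3⟩ : ∃ w, f c1 = w := ⟨_, rfl⟩
  have e4 : g c2 = c1 := by rw [← e3, hgf]
  obtain ⟨c3, e5⟩ : ∃ w, b c2 = w := ⟨_, rfl⟩
  have e6 : b c3 = c2 := by rw [← e5, hb]
  obtain ⟨c4, e7⟩ : ∃ w, f c3 = w := ⟨_, rfl⟩
  have e8 : g c4 = c3 := by rw [← e7, hgf]
  obtain ⟨c5, e9⟩ : ∃ w, f c4 = w := ⟨_, rfl⟩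
  have e10 : g c5 = c4 := by rw [← e9, hgf]
  obtain ⟨c6, e11⟩ : ∃ w, b c5 = w := ⟨_, rfl⟩
  have e12 : b c6 = c5 := by rw [← e11, hb]
  obtain ⟨c7, e13⟩ : ∃ w, f c6 = w := ⟨_, rfl⟩
  have e14 : g c7 = c6 := by rw [← e13, hgf]
  obtain ⟨c8, e15⟩ : ∃ w, f c7 = w := ⟨_, rfl⟩
  have e16 : g c8 = c7 := by rw [← e15, hgf]
  obtain ⟨c9, e17⟩ : ∃ w, b c8 = w := ⟨_, rfl⟩
  have e18 : b c9 = c8 := by rw [← e17, hb]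
  have e19 : f c9 = c1 := (L3ffbffbffb c9).trans (by simp only [e18, e16, e14, e12, e10, e8, e6, e4])
  have e20 : g c1 = c9 := by rw [← e19, hgf]
  obtain ⟨c10, e21⟩ : ∃ w, b c4 = w := ⟨_, rfl⟩
  have e22 : b c10 = c4 := by rw [← e21, hb]
  obtain ⟨c11, e23⟩ : ∃ w, f c10 = w := ⟨_, rfl⟩
  have e24 : g c11 = c10 := by rw [← e23, hgf]
  obtain ⟨c12, e25⟩ : ∃ w, f c11 = w := ⟨_, rfl⟩
  have e26 : g c12 = c11 := by rw [← e25, hgf]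
  obtain ⟨c13, e27⟩ : ∃ w, b c12 = w := ⟨_, rfl⟩
  have e28 : b c13 = c12 := by rw [← e27, hb]
  obtain ⟨c14, e29⟩ : ∃ w, f c13 = w := ⟨_, rfl⟩
  have e30 : g c14 = c13 := by rw [← e29, hgf]
  obtain ⟨c15, e31⟩ : ∃ w, f c14 = w := ⟨_, rfl⟩
  have e32 : g c15 = c14 := by rw [← e31, hgf]
  obtain ⟨c16, e33⟩ : ∃ w, b c15 = w := ⟨_, rfl⟩
  have e34 : b c16 = c15 := by rw [← e33, hb]
  have e35 : f c16 = c3 := (L3ffbffbffb c16).trans (by simp only [e34, e32, e30, e28, e26, e24, e22, e8])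
  have e36 : g c3 = c16 := by rw [← e35, hgf]
  have e37 : f c5 = c16 := (L4f c5).trans (by simp only [e10, e8, e36])
  have e38 : g c16 = c5 := by rw [← e37, hgf]
  obtain ⟨c17, e39⟩ : ∃ w, f c8 = w := ⟨_, rfl⟩
  have e40 : g c17 = c8 := by rw [← e39, hgf]
  obtain ⟨c18, e41⟩ : ∃ w, b c17 = w := ⟨_, rfl⟩
  have e42 : b c18 = c17 := by rw [← e41, hb]
  obtain ⟨c19, e43⟩ : ∃ w, f c18 = w := ⟨_, rfl⟩
  have e44 : g c19 = c18 := by rw [← e43, hgf]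
  obtain ⟨c20, e45⟩ : ∃ w, f c19 = w := ⟨_, rfl⟩
  have e46 : g c20 = c19 := by rw [← e45, hgf]
  obtain ⟨c21, e47⟩ : ∃ w, b c20 = w := ⟨_, rfl⟩
  have e48 : b c21 = c20 := by rw [← e47, hb]
  obtain ⟨c22, e49⟩ : ∃ w, f c21 = w := ⟨_, rfl⟩
  have e50 : g c22 = c21 := by rw [← e49, hgf]
  obtain ⟨c23, e51⟩ : ∃ w, f c22 = w := ⟨_, rfl⟩
  have e52 : g c23 = c22 := by rw [← e51, hgf]
  have e53 : b c23 = c7 := (L3bffbffbff c23).trans (by simp only [e52, e50, e48, e46, e44, e42, e40, e16])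
  have e54 : b c7 = c23 := by rw [← e53, hb]
  have e55 : f c17 = c6 := (L4f c17).trans (by simp only [e40, e16, e14])
  have e56 : g c6 = c17 := by rw [← e55, hgf]
  obtain ⟨c24, e57⟩ : ∃ w, b c11 = w := ⟨_, rfl⟩
  have e58 : b c24 = c11 := by rw [← e57, hb]
  obtain ⟨c25, e59⟩ : ∃ w, f c24 = w := ⟨_, rfl⟩
  have e60 : g c25 = c24 := by rw [← e59, hgf]
  obtain ⟨c26, e61⟩ : ∃ w, b c25 = w := ⟨_, rfl⟩
  have e62 : b c26 = c25 := by rw [← e61, hb]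
  obtain ⟨c27, e63⟩ : ∃ w, f c26 = w := ⟨_, rfl⟩
  have e64 : g c27 = c26 := by rw [← e63, hgf]
  have e65 : b c27 = c22 := (L9bf c27).trans (by simp only [e64, e62, e60, e58, e24, e22, e8, e6, e4, e2, e0, e1, e20, e18, e16, e54, e52])
  have e66 : b c22 = c27 := by rw [← e65, hb]
  obtain ⟨c28, e67⟩ : ∃ w, f c25 = w := ⟨_, rfl⟩
  have e68 : g c28 = c25 := by rw [← e67, hgf]
  obtain ⟨c29, e69⟩ : ∃ w, b c28 = w := ⟨_, rfl⟩
  have e70 : b c29 = c28 := by rw [← e69, hb]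
  obtain ⟨c30, e71⟩ : ∃ w, f c29 = w := ⟨_, rfl⟩
  have e72 : g c30 = c29 := by rw [← e71, hgf]
  obtain ⟨c31, e73⟩ : ∃ w, f c30 = w := ⟨_, rfl⟩
  have e74 : g c31 = c30 := by rw [← e73, hgf]
  obtain ⟨c32, e75⟩ : ∃ w, b c31 = w := ⟨_, rfl⟩
  have e76 : b c32 = c31 := by rw [← e75, hb]
  have e77 : f c32 = c10 := (L3ffbffbffb c32).trans (by simp only [e76, e74, e72, e70, e68, e60, e58, e24])
  have e78 : g c10 = c32 := by rw [← e77, hgf]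
  have e79 : f c12 = c32 := (L4f c12).trans (by simp only [e26, e24, e78])
  have e80 : g c32 = c12 := by rw [← e79, hgf]
  obtain ⟨c33, e81⟩ : ∃ w, f c23 = w := ⟨_, rfl⟩
  have e82 : g c33 = c23 := by rw [← e81, hgf]
  obtain ⟨c34, e83⟩ : ∃ w, b c33 = w := ⟨_, rfl⟩
  have e84 : b c34 = c33 := by rw [← e83, hb]
  obtain ⟨c35, e85⟩ : ∃ w, f c34 = w := ⟨_, rfl⟩
  have e86 : g c35 = c34 := by rw [← e85, hgf]
  obtain ⟨c36, e87⟩ : ∃ w, f c35 = w := ⟨_, rfl⟩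
  have e88 : g c36 = c35 := by rw [← e87, hgf]
  obtain ⟨c37, e89⟩ : ∃ w, b c36 = w := ⟨_, rfl⟩
  have e90 : b c37 = c36 := by rw [← e89, hb]
  have e91 : f c37 = c26 := (L3ffbffbffb c37).trans (by simp only [e90, e88, e86, e84, e82, e52, e66, e64])
  have e92 : g c26 = c37 := by rw [← e91, hgf]
  have e93 : f c33 = c21 := (L4f c33).trans (by simp only [e82, e52, e50])
  have e94 : g c21 = c33 := by rw [← e93, hgf]
  obtain ⟨c38, e95⟩ : ∃ w, f c31 = w := ⟨_, rfl⟩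
  have e96 : g c38 = c31 := by rw [← e95, hgf]
  obtain ⟨c39, e97⟩ : ∃ w, b c38 = w := ⟨_, rfl⟩
  have e98 : b c39 = c38 := by rw [← e97, hb]
  obtain ⟨c40, e99⟩ : ∃ w, f c39 = w := ⟨_, rfl⟩
  have e100 : g c40 = c39 := by rw [← e99, hgf]
  obtain ⟨c41, e101⟩ : ∃ w, f c40 = w := ⟨_, rfl⟩
  have e102 : g c41 = c40 := by rw [← e101, hgf]
  obtain ⟨c42, e103⟩ : ∃ w, b c41 = w := ⟨_, rfl⟩
  have e104 : b c42 = c41 := by rw [← e103, hb]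
  obtain ⟨c43, e105⟩ : ∃ w, f c42 = w := ⟨_, rfl⟩
  have e106 : g c43 = c42 := by rw [← e105, hgf]
  obtain ⟨c44, e107⟩ : ∃ w, f c43 = w := ⟨_, rfl⟩
  have e108 : g c44 = c43 := by rw [← e107, hgf]
  have e109 : b c44 = c30 := (L3bffbffbff c44).trans (by simp only [e108, e106, e104, e102, e100, e98, e96, e74])
  have e110 : b c30 = c44 := by rw [← e109, hb]
  have e111 : f c38 = c29 := (L4f c38).trans (by simp only [e96, e74, e72])
  have e112 : g c29 = c38 := by rw [← e111, hgf]
  obtain ⟨c45, e113⟩ : ∃ w, f c15 = w := ⟨_, rfl⟩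
  have e114 : g c45 = c15 := by rw [← e113, hgf]
  obtain ⟨c46, e115⟩ : ∃ w, b c45 = w := ⟨_, rfl⟩
  have e116 : b c46 = c45 := by rw [← e115, hb]
  obtain ⟨c47, e117⟩ : ∃ w, f c46 = w := ⟨_, rfl⟩
  have e118 : g c47 = c46 := by rw [← e117, hgf]
  obtain ⟨c48, e119⟩ : ∃ w, b c47 = w := ⟨_, rfl⟩
  have e120 : b c48 = c47 := by rw [← e119, hb]
  obtain ⟨c49, e121⟩ : ∃ w, f c48 = w := ⟨_, rfl⟩
  have e122 : g c49 = c48 := by rw [← e121, hgf]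
  obtain ⟨c50, e123⟩ : ∃ w, f c49 = w := ⟨_, rfl⟩
  have e124 : g c50 = c49 := by rw [← e123, hgf]
  obtain ⟨c51, e125⟩ : ∃ w, b c50 = w := ⟨_, rfl⟩
  have e126 : b c51 = c50 := by rw [← e125, hb]
  obtain ⟨c52, e127⟩ : ∃ w, f c51 = w := ⟨_, rfl⟩
  have e128 : g c52 = c51 := by rw [← e127, hgf]
  obtain ⟨c53, e129⟩ : ∃ w, f c52 = w := ⟨_, rfl⟩
  have e130 : g c53 = c52 := by rw [← e129, hgf]
  obtain ⟨c54, e131⟩ : ∃ w, b c53 = w := ⟨_, rfl⟩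
  have e132 : b c54 = c53 := by rw [← e131, hb]
  have e133 : f c54 = c46 := (L3ffbffbffb c54).trans (by simp only [e132, e130, e128, e126, e124, e122, e120, e118])
  have e134 : g c46 = c54 := by rw [← e133, hgf]
  have e135 : f c45 = c13 := (L4f c45).trans (by simp only [e114, e32, e30])
  have e136 : g c13 = c45 := by rw [← e135, hgf]
  obtain ⟨c55, e137⟩ : ∃ w, g c18 = w := ⟨_, rfl⟩
  have e138 : f c55 = c18 := by rw [← e137, hfg]
  obtain ⟨c56, e139⟩ : ∃ w, b c55 = w := ⟨_, rfl⟩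
  have e140 : b c56 = c55 := by rw [← e139, hb]
  obtain ⟨c57, e141⟩ : ∃ w, f c56 = w := ⟨_, rfl⟩
  have e142 : g c57 = c56 := by rw [← e141, hgf]
  obtain ⟨c58, e143⟩ : ∃ w, b c57 = w := ⟨_, rfl⟩
  have e144 : b c58 = c57 := by rw [← e143, hb]
  obtain ⟨c59, e145⟩ : ∃ w, f c58 = w := ⟨_, rfl⟩
  have e146 : g c59 = c58 := by rw [← e145, hgf]
  obtain ⟨c60, e147⟩ : ∃ w, f c59 = w := ⟨_, rfl⟩
  have e148 : g c60 = c59 := by rw [← e147, hgf]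
  obtain ⟨c61, e149⟩ : ∃ w, b c60 = w := ⟨_, rfl⟩
  have e150 : b c61 = c60 := by rw [← e149, hb]
  obtain ⟨c62, e151⟩ : ∃ w, f c61 = w := ⟨_, rfl⟩
  have e152 : g c62 = c61 := by rw [← e151, hgf]
  obtain ⟨c63, e153⟩ : ∃ w, f c62 = w := ⟨_, rfl⟩
  have e154 : g c63 = c62 := by rw [← e153, hgf]
  obtain ⟨c64, e155⟩ : ∃ w, b c63 = w := ⟨_, rfl⟩
  have e156 : b c64 = c63 := by rw [← e155, hb]
  have e157 : f c64 = c56 := (L3ffbffbffb c64).trans (by simp only [e156, e154, e152, e150, e148, e146, e144, e142])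
  have e158 : g c56 = c64 := by rw [← e157, hgf]
  have e159 : f c20 = c55 := (L4f c20).trans (by simp only [e46, e44, e137])
  have e160 : g c55 = c20 := by rw [← e159, hgf]
  obtain ⟨c65, e161⟩ : ∃ w, b c49 = w := ⟨_, rfl⟩
  have e162 : b c65 = c49 := by rw [← e161, hb]
  obtain ⟨c66, e163⟩ : ∃ w, f c65 = w := ⟨_, rfl⟩
  have e164 : g c66 = c65 := by rw [← e163, hgf]
  have e165 : b c66 = c62 := (L9bf c66).trans (by simp only [e164, e162, e122, e120, e118, e116, e114, e33, e38, e11, e56, e41, e137, e139, e158, e156, e154])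
  have e166 : b c62 = c66 := by rw [← e165, hb]
  obtain ⟨c67, e167⟩ : ∃ w, b c35 = w := ⟨_, rfl⟩
  have e168 : b c67 = c35 := by rw [← e167, hb]
  obtain ⟨c68, e169⟩ : ∃ w, f c67 = w := ⟨_, rfl⟩
  have e170 : g c68 = c67 := by rw [← e169, hgf]
  obtain ⟨c69, e171⟩ : ∃ w, b c68 = w := ⟨_, rfl⟩
  have e172 : b c69 = c68 := by rw [← e171, hb]
  obtain ⟨c70, e173⟩ : ∃ w, f c69 = w := ⟨_, rfl⟩
  have e174 : g c70 = c69 := by rw [← e173, hgf]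
  have e175 : b c70 = c43 := (L9bf c70).trans (by simp only [e174, e172, e170, e168, e86, e84, e82, e53, e14, e12, e10, e21, e78, e76, e74, e110, e108])
  have e176 : b c43 = c70 := by rw [← e175, hb]
  obtain ⟨c71, e177⟩ : ∃ w, f c68 = w := ⟨_, rfl⟩
  have e178 : g c71 = c68 := by rw [← e177, hgf]
  obtain ⟨c72, e179⟩ : ∃ w, b c71 = w := ⟨_, rfl⟩
  have e180 : b c72 = c71 := by rw [← e179, hb]
  obtain ⟨c73, e181⟩ : ∃ w, f c72 = w := ⟨_, rfl⟩
  have e182 : g c73 = c72 := by rw [← e181, hgf]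
  obtain ⟨c74, e183⟩ : ∃ w, f c73 = w := ⟨_, rfl⟩
  have e184 : g c74 = c73 := by rw [← e183, hgf]
  obtain ⟨c75, e185⟩ : ∃ w, b c74 = w := ⟨_, rfl⟩
  have e186 : b c75 = c74 := by rw [← e185, hb]
  have e187 : f c75 = c34 := (L3ffbffbffb c75).trans (by simp only [e186, e184, e182, e180, e178, e170, e168, e86])
  have e188 : g c34 = c75 := by rw [← e187, hgf]
  have e189 : f c36 = c75 := (L4f c36).trans (by simp only [e88, e86, e188])
  have e190 : g c75 = c36 := by rw [← e189, hgf]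
  obtain ⟨c76, e191⟩ : ∃ w, f c44 = w := ⟨_, rfl⟩
  have e192 : g c76 = c44 := by rw [← e191, hgf]
  obtain ⟨c77, e193⟩ : ∃ w, b c76 = w := ⟨_, rfl⟩
  have e194 : b c77 = c76 := by rw [← e193, hb]
  obtain ⟨c78, e195⟩ : ∃ w, f c77 = w := ⟨_, rfl⟩
  have e196 : g c78 = c77 := by rw [← e195, hgf]
  obtain ⟨c79, e197⟩ : ∃ w, f c78 = w := ⟨_, rfl⟩
  have e198 : g c79 = c78 := by rw [← e197, hgf]
  obtain ⟨c80, e199⟩ : ∃ w, b c79 = w := ⟨_, rfl⟩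
  have e200 : b c80 = c79 := by rw [← e199, hb]
  have e201 : f c80 = c69 := (L3ffbffbffb c80).trans (by simp only [e200, e198, e196, e194, e192, e108, e176, e174])
  have e202 : g c69 = c80 := by rw [← e201, hgf]
  have e203 : f c76 = c42 := (L4f c76).trans (by simp only [e192, e108, e106])
  have e204 : g c42 = c76 := by rw [← e203, hgf]
  obtain ⟨c81, e205⟩ : ∃ w, f c70 = w := ⟨_, rfl⟩
  have e206 : g c81 = c70 := by rw [← e205, hgf]
  obtain ⟨c82, e207⟩ : ∃ w, b c81 = w := ⟨_, rfl⟩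
  have e208 : b c82 = c81 := by rw [← e207, hb]
  obtain ⟨c83, e209⟩ : ∃ w, f c82 = w := ⟨_, rfl⟩
  have e210 : g c83 = c82 := by rw [← e209, hgf]
  obtain ⟨c84, e211⟩ : ∃ w, f c83 = w := ⟨_, rfl⟩
  have e212 : g c84 = c83 := by rw [← e211, hgf]
  obtain ⟨c85, e213⟩ : ∃ w, b c84 = w := ⟨_, rfl⟩
  have e214 : b c85 = c84 := by rw [← e213, hb]
  have e215 : f c85 = c67 := (L3ffbffbffb c85).trans (by simp only [e214, e212, e210, e208, e206, e174, e172, e170])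
  have e216 : g c67 = c85 := by rw [← e215, hgf]
  have e217 : f c71 = c85 := (L4f c71).trans (by simp only [e178, e170, e216])
  have e218 : g c85 = c71 := by rw [← e217, hgf]
  have e219 : f c81 = c80 := (L4f c81).trans (by simp only [e206, e174, e202])
  have e220 : g c80 = c81 := by rw [← e219, hgf]
  obtain ⟨c86, e221⟩ : ∃ w, f c53 = w := ⟨_, rfl⟩
  have e222 : g c86 = c53 := by rw [← e221, hgf]
  obtain ⟨c87, e223⟩ : ∃ w, b c86 = w := ⟨_, rfl⟩
  have e224 : b c87 = c86 := by rw [← e223, hb]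
  obtain ⟨c88, e225⟩ : ∃ w, f c87 = w := ⟨_, rfl⟩
  have e226 : g c88 = c87 := by rw [← e225, hgf]
  obtain ⟨c89, e227⟩ : ∃ w, f c88 = w := ⟨_, rfl⟩
  have e228 : g c89 = c88 := by rw [← e227, hgf]
  obtain ⟨c90, e229⟩ : ∃ w, b c89 = w := ⟨_, rfl⟩
  have e230 : b c90 = c89 := by rw [← e229, hb]
  obtain ⟨c91, e231⟩ : ∃ w, f c90 = w := ⟨_, rfl⟩
  have e232 : g c91 = c90 := by rw [← e231, hgf]
  obtain ⟨c92, e233⟩ : ∃ w, f c91 = w := ⟨_, rfl⟩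
  have e234 : g c92 = c91 := by rw [← e233, hgf]
  have e235 : b c92 = c52 := (L3bffbffbff c92).trans (by simp only [e234, e232, e230, e228, e226, e224, e222, e130])
  have e236 : b c52 = c92 := by rw [← e235, hb]
  have e237 : f c86 = c51 := (L4f c86).trans (by simp only [e222, e130, e128])
  have e238 : g c51 = c86 := by rw [← e237, hgf]
  obtain ⟨c93, e239⟩ : ∃ w, b c40 = w := ⟨_, rfl⟩
  have e240 : b c93 = c40 := by rw [← e239, hb]
  obtain ⟨c94, e241⟩ : ∃ w, f c93 = w := ⟨_, rfl⟩
  have e242 : g c94 = c93 := by rw [← e241, hgf]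
  obtain ⟨c95, e243⟩ : ∃ w, b c94 = w := ⟨_, rfl⟩
  have e244 : b c95 = c94 := by rw [← e243, hb]
  obtain ⟨c96, e245⟩ : ∃ w, f c95 = w := ⟨_, rfl⟩
  have e246 : g c96 = c95 := by rw [← e245, hgf]
  have e247 : b c96 = c91 := (L9bf c96).trans (by simp only [e246, e244, e242, e240, e100, e98, e96, e75, e80, e27, e136, e115, e134, e132, e130, e236, e234])
  have e248 : b c91 = c96 := by rw [← e247, hb]
  obtain ⟨c97, e249⟩ : ∃ w, b c78 = w := ⟨_, rfl⟩
  have e250 : b c97 = c78 := by rw [← e249, hb]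
  obtain ⟨c98, e251⟩ : ∃ w, f c97 = w := ⟨_, rfl⟩
  have e252 : g c98 = c97 := by rw [← e251, hgf]
  have e253 : b c98 = c83 := (L9bf c98).trans (by simp only [e252, e250, e196, e194, e192, e109, e72, e70, e68, e61, e92, e90, e88, e167, e216, e214, e212])
  have e254 : b c83 = c98 := by rw [← e253, hb]
  have e255 : c78 = c82 := (e210.symm.trans ((Lcgbfb c83).trans (by simp only [e254, e252, e250, e197, e199, e220, e207, e209]))).symm
  subst e255
  have e256 : c81 = c97 := (e249.symm.trans e208).symm
  subst e256
  have e257 : c79 = c83 := e197.symm.trans e209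
  subst e257
  have e258 : c80 = c98 := e219.symm.trans e251
  subst e258
  have e259 : f c84 = c77 := (L4f c84).trans (by simp only [e212, e198, e196])
  have e260 : g c77 = c84 := by rw [← e259, hgf]
  obtain ⟨c99, e261⟩ : ∃ w, b c73 = w := ⟨_, rfl⟩
  have e262 : b c99 = c73 := by rw [← e261, hb]
  obtain ⟨c100, e263⟩ : ∃ w, f c99 = w := ⟨_, rfl⟩
  have e264 : g c100 = c99 := by rw [← e263, hgf]
  obtain ⟨c101, e265⟩ : ∃ w, b c100 = w := ⟨_, rfl⟩
  have e266 : b c101 = c100 := by rw [← e265, hb]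
  have e267 : f c101 = c93 := (L9fb c101).trans (by simp only [e266, e264, e262, e182, e180, e178, e171, e202, e200, e198, e249, e206, e175, e106, e104, e102, e239])
  have e268 : g c93 = c101 := by rw [← e267, hgf]
  obtain ⟨c102, e269⟩ : ∃ w, b c59 = w := ⟨_, rfl⟩
  have e270 : b c102 = c59 := by rw [← e269, hb]
  obtain ⟨c103, e271⟩ : ∃ w, f c102 = w := ⟨_, rfl⟩
  have e272 : g c103 = c102 := by rw [← e271, hgf]
  obtain ⟨c104, e273⟩ : ∃ w, b c103 = w := ⟨_, rfl⟩
  have e274 : b c104 = c103 := by rw [← e273, hb]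
  obtain ⟨c105, e275⟩ : ∃ w, f c104 = w := ⟨_, rfl⟩
  have e276 : g c105 = c104 := by rw [← e275, hgf]
  obtain ⟨c106, e277⟩ : ∃ w, b c105 = w := ⟨_, rfl⟩
  have e278 : b c106 = c105 := by rw [← e277, hb]
  have e279 : f c106 = c99 := (L9fb c106).trans (by simp only [e278, e276, e274, e272, e270, e146, e144, e142, e140, e160, e47, e94, e83, e188, e186, e184, e261])
  have e280 : g c99 = c106 := by rw [← e279, hgf]
  have e281 : c96 = c104 := (e276.symm.trans ((congrArg g (show f c96 = c105 from (L3fbffbffbf c96).trans (by simp only [e246, e244, e242, e268, e266, e264, e280, e278])).symm).trans (hgf c96))).symm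
  subst e281
  have e282 : c91 = c103 := e247.symm.trans e274
  subst e282
  have e283 : c90 = c102 := e232.symm.trans e272
  subst e283
  have e284 : c59 = c89 := (e230.symm.trans e270).symm
  subst e284
  have e285 : c58 = c88 := e146.symm.trans e228
  subst e285
  have e286 : f c60 = c87 := (L4f c60).trans (by simp only [e148, e146, e226])
  have e287 : g c87 = c60 := by rw [← e286, hgf]
  have e288 : c50 = c58 := (e225.symm.trans ((Lcfbgb c87).trans (by simp only [e224, e237, e126, e124, e161, e163, e165, e152, e150, e286, e222, e131, e133, e116, e114, e33, e35, e6, e4, e2, h0, e1, e20, e18, e39, e41, e137, e139, e141, e143, e226]))).symm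
  subst e288
  have e289 : c51 = c57 := e125.symm.trans e144
  subst e289
  have e290 : c49 = c87 := e124.symm.trans e226
  subst e290
  have e291 : c56 = c86 := (e238.symm.trans e142).symm
  subst e291
  have e292 : c56 = c65 := (e161.symm.trans e224).symm
  subst e292
  have e293 : c48 = c60 := e122.symm.trans e287
  subst e293
  have e294 : c53 = c64 := (e158.symm.trans e222).symm
  subst e294
  have e295 : c49 = c55 := (e140.symm.trans e223).symm
  subst e295
  have e296 : c51 = c66 := e141.symm.trans e163
  subst e296
  have e297 : c47 = c61 := e120.symm.trans e149
  subst e297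
  have e298 : c54 = c63 := e131.symm.trans e156
  subst e298
  have e299 : c18 = c50 := (e123.symm.trans e138).symm
  subst e299
  have e300 : c20 = c48 := (e122.symm.trans e160).symm
  subst e300
  have e301 : c18 = c62 := e126.symm.trans e165
  subst e301
  have e302 : c17 = c51 := e42.symm.trans e125
  subst e302
  have e303 : c19 = c59 := e43.symm.trans e145
  subst e303
  have e304 : c21 = c47 := e47.symm.trans e120
  subst e304
  have e305 : c21 = c49 := (e137.symm.trans e152).symm
  subst e305
  have e306 : c19 = c54 := e43.symm.trans e153
  subst e306
  have e307 : c6 = c52 := e55.symm.trans e127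
  subst e307
  have e308 : c8 = c56 := e40.symm.trans e238
  subst e308
  have e309 : c33 = c46 := e94.symm.trans e118
  subst e309
  have e310 : c18 = c22 := (e49.symm.trans e151).symm
  subst e310
  have e311 : c20 = c33 := (e94.symm.trans e122).symm
  subst e311
  have e312 : c8 = c20 := (e48.symm.trans e161).symm
  subst e312
  have e313 : c53 = c90 := (e269.symm.trans e132).symm
  subst e313
  have e314 : c7 = c53 := e13.symm.trans e129
  subst e314
  have e315 : c5 = c92 := e12.symm.trans e236
  subst e315
  have e316 : c9 = c21 := e17.symm.trans e140
  subst e316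
  have e317 : c34 = c45 := e83.symm.trans e116
  subst e317
  have e318 : c19 = c23 := (e82.symm.trans e134).symm
  subst e318
  have e319 : c17 = c27 := e42.symm.trans e66
  subst e319
  have e320 : c9 = c34 := e47.symm.trans e83
  subst e320
  have e321 : c7 = c19 := e16.symm.trans e46
  subst e321
  have e322 : c9 = c17 := (e39.symm.trans e159).symm
  subst e322
  have e323 : c8 = c91 := e221.symm.trans e231
  subst e323
  have e324 : c4 = c8 := e10.symm.trans e234
  subst e324
  have e325 : c1 = c18 := e19.symm.trans e49
  subst e325
  have e326 : c15 = c75 := (e188.symm.trans e114).symm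
  subst e326
  have e327 : c13 = c35 := (e85.symm.trans e135).symm
  subst e327
  have e328 : c4 = c26 := e40.symm.trans e64
  subst e328
  have e329 : c1 = c13 := e19.symm.trans e85
  subst e329
  have e330 : c4 = c15 := e94.symm.trans e188
  subst e330
  have e331 : c1 = c6 := (e14.symm.trans e44).symm
  subst e331
  have e332 : c1 = c4 := (e18.symm.trans e41).symm
  subst e332
  have e333 : c5 = c9 := (e39.symm.trans e233).symm
  subst e333
  have e334 : c5 = c96 := e17.symm.trans e248
  subst e334
  have e335 : c3 = c7 := e8.symm.trans e16
  subst e335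
  have e336 : c5 = c10 := (e21.symm.trans e17).symm
  subst e336
  have e337 : c = c5 := e2.symm.trans e42
  subst e337
  have e338 : c2 = c3 := e3.symm.trans e43
  subst e338
  have e339 : c16 = c74 := e33.symm.trans e186
  subst e339
  have e340 : c14 = c36 := e32.symm.trans e190
  subst e340
  have e341 : c12 = c67 := e28.symm.trans e167
  subst e341
  have e342 : c = c25 := e21.symm.trans e62
  subst e342
  have e343 : c2 = c37 := e8.symm.trans e92
  subst e343
  have e344 : c = c12 := e2.symm.trans e28
  subst e344
  have e345 : c2 = c14 := e3.symm.trans e29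
  subst e345
  have e346 : c = c16 := e21.symm.trans e33
  subst e346
  have e347 : c = c2 := e20.symm.trans e8
  subst e347
  have e348 : c = c1 := e37.symm.trans e19
  subst e348
  have e349 : c = c95 := e10.symm.trans e246
  subst e349
  have e350 : c = c105 := e37.symm.trans e275
  subst e350
  have e351 : c = c11 := e37.symm.trans e23
  subst e351
  have e352 : c = c32 := e10.symm.trans e78
  subst e352
  have e353 : c = c73 := e38.symm.trans e184
  subst e353
  have e354 : c = c68 := e79.symm.trans e169
  subst e354
  have e355 : c = c85 := e26.symm.trans e216
  subst e355
  have e356 : c = c24 := e0.symm.trans e60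
  subst e356
  have e357 : c = c28 := h0.symm.trans e67
  subst e357
  have e358 : c = c94 := e1.symm.trans e244
  subst e358
  have e359 : c = c106 := e1.symm.trans e277
  subst e359
  have e360 : c = c31 := e1.symm.trans e76
  subst e360
  have e361 : c = c72 := e0.symm.trans e182
  subst e361
  have e362 : c = c99 := e1.symm.trans e261
  subst e362
  have e363 : c = c69 := e1.symm.trans e171
  subst e363
  have e364 : c = c71 := h0.symm.trans e177
  subst e364
  have e365 : c = c84 := e1.symm.trans e214
  subst e365
  have e366 : c = c29 := e1.symm.trans e69
  subst e366
  have e367 : c = c93 := e0.symm.trans e242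
  subst e367
  have e368 : c = c30 := e0.symm.trans e74
  subst e368
  have e369 : c = c38 := h0.symm.trans e95
  subst e369
  have e370 : c = c100 := h0.symm.trans e263
  subst e370
  have e371 : c = c70 := h0.symm.trans e173
  subst e371
  have e372 : c = c80 := e0.symm.trans e202
  subst e372
  have e373 : c = c79 := e0.symm.trans e212
  subst e373
  have e374 : c = c77 := h0.symm.trans e259
  subst e374
  have e375 : c = c40 := e1.symm.trans e240
  subst e375
  have e376 : c = c101 := e0.symm.trans e268
  subst e376
  have e377 : c = c44 := e1.symm.trans e110
  subst e377
  have e378 : c = c39 := e1.symm.trans e97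
  subst e378
  have e379 : c = c43 := e1.symm.trans e175
  subst e379
  have e380 : c = c81 := h0.symm.trans e205
  subst e380
  have e381 : c = c78 := e0.symm.trans e198
  subst e381
  have e382 : c = c76 := e1.symm.trans e194
  subst e382
  have e383 : c = c41 := h0.symm.trans e101
  subst e383
  have e384 : c = c42 := e0.symm.trans e106
  subst e384
  exact e1

section aux
variable {G : Type*} [Group G]

theorem order_of_comm_inv (hG : HypHStar G) {a g : G} (ha : a ≠ 1) (ha2 : a ^ 2 = 1)
    (hc : a * g = g * a) : ∃ n : ℕ, orderOf g = 2 ^ n := by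
  obtain ⟨n, hn⟩ := (hG.2 a ha ha2).1 ⟨g, by
    rw [Subgroup.mem_centralizer_singleton_iff]; exact hc.symm⟩
  exact ⟨n, by rw [← hn, Subgroup.orderOf_mk]⟩

/-- An element of even order has an involution among its powers. -/
theorem exists_inv_pow {g : G} (hf : IsOfFinOrder g) (h2 : 2 ∣ orderOf g) :
    ∃ k : ℕ, g ^ k ≠ 1 ∧ (g ^ k) ^ 2 = 1 := by
  obtain ⟨m, hm⟩ := h2
  have hpos : 0 < orderOf g := hf.orderOf_pos
  refine ⟨m, ?_, ?_⟩
  · exact pow_ne_one_of_lt_orderOf (by omega) (by omega)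
  · rw [← pow_mul, mul_comm, ← hm, pow_orderOf_eq_one]

theorem two_or_three (hG : HypHStar G) (g : G) :
    (∃ n : ℕ, orderOf g = 2 ^ n) ∨ (∃ n : ℕ, orderOf g = 3 ^ n) := by
  have hf := hG.1.1 g
  by_cases h2 : 2 ∣ orderOf g
  · left
    obtain ⟨k, hk, hk2⟩ := exists_inv_pow hf h2
    exact order_of_comm_inv hG hk hk2 (by rw [← pow_succ, ← pow_succ'])
  · right
    refine ⟨_, Nat.eq_prime_pow_of_unique_prime_dvd hf.orderOf_pos.ne' ?_⟩
    intro d hd hdv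
    rcases (hG.1.2.1 d hd).1 ⟨g, hdv⟩ with h | h
    · subst h; exact absurd hdv h2
    · exact h

theorem pow_eight_or_nine (hG : HypHStar G) {g : G} (h : orderOf g ≤ 9) :
    g ^ 8 = 1 ∨ g ^ 9 = 1 := by
  rcases two_or_three hG g with ⟨n, hn⟩ | ⟨n, hn⟩
  · left
    apply orderOf_dvd_iff_pow_eq_one.1
    rw [hn] at h ⊢
    have : n ≤ 3 := by
      by_contra hh
      have : 2 ^ 4 ≤ 2 ^ n := Nat.pow_le_pow_right (by norm_num) (by omega)
      omega
    exact pow_dvd_pow 2 this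
  · right
    apply orderOf_dvd_iff_pow_eq_one.1
    rw [hn] at h ⊢
    have : n ≤ 2 := by
      by_contra hh
      have : 3 ^ 3 ≤ 3 ^ n := Nat.pow_le_pow_right (by norm_num) (by omega)
      omega
    exact pow_dvd_pow 3 this

/-- Commuting involutions coincide. -/
theorem involution_unique (hG : HypHStar G) {a i : G} (ha : a ≠ 1) (ha2 : a ^ 2 = 1)
    (hi : i ≠ 1) (hi2 : i ^ 2 = 1) (hc : a * i = i * a) : a = i := by
  have hmi : i ∈ Subgroup.centralizer {i} := by
    rw [Subgroup.mem_centralizer_singleton_iff]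
  have hma : a ∈ Subgroup.centralizer {i} := by
    rw [Subgroup.mem_centralizer_singleton_iff]; exact hc
  let A : Subgroup.centralizer {i} := ⟨a, hma⟩
  let B : Subgroup.centralizer {i} := ⟨i, hmi⟩
  have hcyc : IsCyclic (Subgroup.closure {A, B}) :=
    (hG.2 i hi hi2).2 _ (by
      classical exact ⟨{A, B}, by simp⟩)
  obtain ⟨g, hg⟩ := hcyc.exists_generator
  obtain ⟨m, hm⟩ := hg ⟨A, Subgroup.subset_closure (by simp)⟩
  obtain ⟨n, hn⟩ := hg ⟨B, Subgroup.subset_closure (by simp)⟩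
  have hm' : ((g : Subgroup.centralizer {i}) : G) ^ m = a := by
    have := congrArg (fun u : Subgroup.closure {A, B} => ((u : Subgroup.centralizer {i}) : G)) hm
    simpa [A] using this
  have hn' : ((g : Subgroup.centralizer {i}) : G) ^ n = i := by
    have := congrArg (fun u : Subgroup.closure {A, B} => ((u : Subgroup.centralizer {i}) : G)) hn
    simpa [B] using this
  generalize ((g : Subgroup.centralizer {i}) : G) = w at hm' hn'
  have hpos : 0 < orderOf w := (hG.1.1 w).orderOf_pos
  have key : ∀ k : ℤ, w ^ k ≠ 1 → (w ^ k) ^ 2 = 1 →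
      ∃ j : ℤ, 2 * k = orderOf w * (2 * j + 1) := by
    intro k h1 h2
    have h3 : (orderOf w : ℤ) ∣ k * 2 := by
      rw [orderOf_dvd_iff_zpow_eq_one, zpow_mul]; exact_mod_cast h2
    obtain ⟨j, hj⟩ := h3
    rcases Int.even_or_odd' j with ⟨l, rfl | rfl⟩
    · exfalso; apply h1
      rw [← orderOf_dvd_iff_zpow_eq_one]
      exact ⟨l, by linarith⟩
    · exact ⟨l, by linarith⟩
  obtain ⟨j, hj⟩ := key m (by rwa [hm']) (by rwa [hm'])
  obtain ⟨l, hl⟩ := key n (by rwa [hn']) (by rwa [hn'])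
  rw [← hm', ← hn']
  rw [← mul_inv_eq_one, ← zpow_neg, ← zpow_add, ← orderOf_dvd_iff_zpow_eq_one]
  exact ⟨j - l, by linarith⟩

/-- The product of two involutions has order dividing 9. -/
theorem inv_mul_inv (hG : HypHStar G) {a b : G} (ha : a ≠ 1) (ha2 : a ^ 2 = 1)
    (hb : b ≠ 1) (hb2 : b ^ 2 = 1) : (a * b) ^ 9 = 1 := by
  have oa : orderOf a ≤ 4 := (Nat.le_of_dvd (by norm_num) (orderOf_dvd_of_pow_eq_one ha2)).trans
    (by norm_num)
  have ob : orderOf b ≤ 4 := (Nat.le_of_dvd (by norm_num) (orderOf_dvd_of_pow_eq_one hb2)).trans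
    (by norm_num)
  have ha' : a * a = 1 := by rw [← pow_two, ha2]
  have hb' : b * b = 1 := by rw [← pow_two, hb2]
  have hai : a⁻¹ = a := inv_eq_of_mul_eq_one_left ha'
  have hbi : b⁻¹ = b := inv_eq_of_mul_eq_one_left hb'
  by_cases h2 : 2 ∣ orderOf (a * b)
  · obtain ⟨k, hk, hk2⟩ := exists_inv_pow (hG.1.1 _) h2
    have hki : ((a * b) ^ k)⁻¹ = (a * b) ^ k := by
      apply inv_eq_of_mul_eq_one_left; rw [← pow_two, hk2]
    have e1 : a * (a * b) ^ k * a⁻¹ = (a * b) ^ k := by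
      rw [← conj_pow, ← hki, ← inv_pow, mul_inv_rev, hai, hbi, ← mul_assoc, ha', one_mul]
    have e2 : b⁻¹ * (a * b) ^ k * b = (a * b) ^ k := by
      have := conj_pow (i := k) (a := b⁻¹) (b := a * b)
      rw [inv_inv] at this
      rw [← this]
      conv_rhs => rw [← hki, ← inv_pow, mul_inv_rev, hai, hbi]
      rw [hbi, mul_assoc, mul_assoc, hb', mul_one]
    have e1' : a * (a * b) ^ k = (a * b) ^ k * a := by
      rw [← mul_inv_eq_iff_eq_mul]; exact e1
    have e2' : b * (a * b) ^ k = (a * b) ^ k * b := by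
      have : b⁻¹ * (a * b) ^ k * b = (a * b) ^ k := e2
      calc b * (a * b) ^ k = b * (b⁻¹ * (a * b) ^ k * b) := by rw [e2]
        _ = _ := by group
    have f1 := involution_unique hG ha ha2 hk hk2 e1'
    have f2 := involution_unique hG hb hb2 hk hk2 e2'
    have : a * b = 1 := by
      have : a = b := f1.trans f2.symm
      rw [this, hb']
    rw [this, one_pow]
  · rcases two_or_three hG (a * b) with ⟨n, hn⟩ | ⟨n, hn⟩
    · rcases n with _ | n
      · rw [pow_zero, orderOf_eq_one_iff] at hn
        rw [hn, one_pow]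
      · exact absurd (by rw [hn]; exact dvd_pow_self 2 (by omega)) h2
    · rcases pow_eight_or_nine hG (hG.1.2.2 a b oa ob) with h | h
      · have h8 : orderOf (a * b) ∣ 2 ^ 3 := orderOf_dvd_of_pow_eq_one h
        rw [Nat.dvd_prime_pow Nat.prime_two] at h8
        obtain ⟨m, -, hm⟩ := h8
        rcases m with _ | m
        · rw [pow_zero, orderOf_eq_one_iff] at hm
          rw [hm, one_pow]
        · exact absurd (by rw [hm]; exact dvd_pow_self 2 (by omega)) h2
      · exact h

/-- An involution does not commute with an element of order 3. -/
theorem not_comm (hG : HypHStar G) {a X : G} (ha : a ≠ 1) (ha2 : a ^ 2 = 1)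
    (hX : X ≠ 1) (hX3 : X ^ 3 = 1) (hc : a * X = X * a) : False := by
  obtain ⟨n, hn⟩ := order_of_comm_inv hG ha ha2 hc
  have h3 : orderOf X = 3 := orderOf_eq_prime hX3 hX
  rw [h3] at hn
  rcases n with _ | n
  · simp at hn
  · rw [pow_succ] at hn; omega

/-- The centralizer of an element of order 3 inverted by an involution is inverted by it. -/
theorem centralizer_inverted (hG : HypHStar G) {z X : G} (hz : z ≠ 1) (hz2 : z ^ 2 = 1)
    (hX : X ≠ 1) (hX3 : X ^ 3 = 1) (hi : z * X * z⁻¹ = X⁻¹) {g : G} (hg : Commute g X) :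
    z * g * z⁻¹ = g⁻¹ := by
  have hzz : z * z = 1 := by rw [← pow_two, hz2]
  have hzi : z⁻¹ = z := inv_eq_of_mul_eq_one_left hzz
  have hzg : Commute (z * g * z⁻¹) X := by
    have : Commute (z * g * z⁻¹) (z * X * z⁻¹) := by
      unfold Commute SemiconjBy at *
      calc z * g * z⁻¹ * (z * X * z⁻¹) = z * (g * X) * z⁻¹ := by group
        _ = z * (X * g) * z⁻¹ := by rw [hg]
        _ = _ := by group
    rw [hi] at this
    exact Commute.inv_right_iff.1 this
  set h := g⁻¹ * (z * g * z⁻¹) with hh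
  have hhX : Commute h X := hg.inv_left.mul_left hzg
  have hodd : ¬ 2 ∣ orderOf h := by
    intro h2
    obtain ⟨k, hk, hk2⟩ := exists_inv_pow (hG.1.1 _) h2
    exact not_comm hG hk hk2 hX hX3 (hhX.pow_left k)
  obtain ⟨m, hm⟩ : ∃ m, orderOf h + 1 = 2 * m := by
    obtain ⟨m, hm⟩ := Nat.odd_iff.2 (Nat.two_dvd_ne_zero.1 hodd)
    exact ⟨m + 1, by omega⟩
  have hk2 : h ^ m * h ^ m = h := by
    rw [← pow_add, ← two_mul, ← hm, pow_succ, pow_orderOf_eq_one, one_mul]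
  have hzh : z * h * z⁻¹ = h⁻¹ := by
    rw [hh, hzi]
    calc z * (g⁻¹ * (z * g * z)) * z = z * g⁻¹ * z * g * (z * z) := by group
      _ = z * g⁻¹ * z * g := by rw [hzz, mul_one]
      _ = z⁻¹ * g⁻¹ * z⁻¹ * g := by rw [hzi]
      _ = _ := by group
  have hzk : z * h ^ m * z⁻¹ = (h ^ m)⁻¹ := by rw [← conj_pow, hzh, inv_pow]
  have hgk : z * (g * h ^ m) * z⁻¹ = g * h ^ m := by
    calc z * (g * h ^ m) * z⁻¹ = g * (g⁻¹ * (z * g * z⁻¹)) * (z * h ^ m * z⁻¹) := by group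
      _ = g * h * (h ^ m)⁻¹ := by rw [← hh, hzk]
      _ = g * (h ^ m * h ^ m) * (h ^ m)⁻¹ := by rw [hk2]
      _ = _ := by group
  have hgX : Commute (g * h ^ m) X := hg.mul_left (hhX.pow_left m)
  have h1 : g * h ^ m = 1 := by
    obtain ⟨n, hn⟩ := order_of_comm_inv hG hz hz2 (mul_inv_eq_iff_eq_mul.1 hgk)
    rcases n with _ | n
    · rwa [pow_zero, orderOf_eq_one_iff] at hn
    · exfalso
      obtain ⟨k, hk, hk2⟩ := exists_inv_pow (hG.1.1 (g * h ^ m))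
        (by rw [hn]; exact dvd_pow_self 2 (by omega))
      exact not_comm hG hk hk2 hX hX3 (hgX.pow_left k)
  have h4 : g = (h ^ m)⁻¹ := eq_inv_of_mul_eq_one_left h1
  calc z * g * z⁻¹ = (z * h ^ m * z⁻¹)⁻¹ := by rw [h4]; group
    _ = g⁻¹ := by rw [hzk, h4]

theorem centralizer_comm (hG : HypHStar G) {z X : G} (hz : z ≠ 1) (hz2 : z ^ 2 = 1)
    (hX : X ≠ 1) (hX3 : X ^ 3 = 1) (hi : z * X * z⁻¹ = X⁻¹) {g h : G} (hg : Commute g X)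
    (hh : Commute h X) : Commute g h := by
  have h1 := centralizer_inverted hG hz hz2 hX hX3 hi hg
  have h2 := centralizer_inverted hG hz hz2 hX hX3 hi hh
  have h3 := centralizer_inverted hG hz hz2 hX hX3 hi (hg.mul_left hh)
  have h4 : z * (g * h) * z⁻¹ = (z * g * z⁻¹) * (z * h * z⁻¹) := by group
  rw [h3, h1, h2] at h4
  have h5 := congrArg (fun u => u⁻¹) h4
  simp only [mul_inv_rev, inv_inv] at h5
  exact h5

/-- The order 3 case. -/
theorem order_three (hG : HypHStar G) {t X : G} (ht : orderOf t = 4) (hX : X ≠ 1)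
    (hX3 : X ^ 3 = 1) (hi : t ^ 2 * X * (t ^ 2)⁻¹ = X⁻¹) : Commute X (t * X * t⁻¹) := by
  have ht4 : t ^ 4 = 1 := by rw [← ht, pow_orderOf_eq_one]
  have hz : t ^ 2 ≠ 1 := pow_ne_one_of_lt_orderOf (by norm_num) (by omega)
  have hz2 : (t ^ 2) ^ 2 = 1 := by rw [← pow_mul, ht4]
  have hzi : (t ^ 2)⁻¹ = t ^ 2 := inv_eq_of_mul_eq_one_left (by rw [← pow_two, hz2])
  have hzX : t ^ 2 * X = X⁻¹ * t ^ 2 := mul_inv_eq_iff_eq_mul.1 hi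
  have oX : orderOf X = 3 := orderOf_eq_prime hX3 hX
  rcases pow_eight_or_nine hG (hG.1.2.2 t X (by omega) (by omega)) with h8 | h9
  · -- `t * X` is a 2-element
    set Y := t * X * t⁻¹ with hY
    have h4 : (t * X) ^ 4 = Y * X⁻¹ * Y⁻¹ * X := by
      have hi' : t ^ 2 * Y * (t ^ 2)⁻¹ = Y⁻¹ := by
        calc t ^ 2 * Y * (t ^ 2)⁻¹ = t * (t ^ 2 * X * (t ^ 2)⁻¹) * t⁻¹ := by rw [hY]; group
          _ = Y⁻¹ := by rw [hi, hY]; group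
      calc (t * X) ^ 4 = Y * (t ^ 2 * X * (t ^ 2)⁻¹) * (t ^ 2 * Y * (t ^ 2)⁻¹) * t ^ 4 * X := by
            rw [hY]; simp only [pow_succ, pow_zero, one_mul]; group
        _ = _ := by rw [hi, hi', ht4, mul_one]
    by_cases hc : (t * X) ^ 4 = 1
    · rw [hc] at h4
      unfold Commute SemiconjBy
      have h5 : Y * X⁻¹ = X⁻¹ * Y := by
        calc Y * X⁻¹ = (Y * X⁻¹ * Y⁻¹ * X) * X⁻¹ * Y := by group
          _ = _ := by rw [← h4, one_mul]
      calc X * Y = X * (Y * X⁻¹) * X := by group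
        _ = _ := by rw [h5]; group
    · exfalso
      set c := (t * X) ^ 4 with hcdef
      have hc2 : c ^ 2 = 1 := by rw [hcdef, ← pow_mul, h8]
      have hcc : c * c = 1 := by rw [← pow_two, hc2]
      have hci : c⁻¹ = c := inv_eq_of_mul_eq_one_left hcc
      have hV : (c * X⁻¹) ^ 3 = 1 := by
        have : c * X⁻¹ = Y * X⁻¹ * Y⁻¹ := by rw [h4]; group
        rw [this, conj_pow, inv_pow, hX3]; group
      have hVcV : X⁻¹ * c * X⁻¹ = c * X * c := by
        have : (c * X⁻¹) * (c * X⁻¹) * (c * X⁻¹) = 1 := by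
          rw [← hV]; simp only [pow_succ, pow_zero, one_mul]
        calc X⁻¹ * c * X⁻¹ = c⁻¹ * ((c * X⁻¹) * (c * X⁻¹) * (c * X⁻¹)) * X * c⁻¹ := by group
          _ = _ := by rw [this, hci, mul_one]
      have hXX : X * X = X⁻¹ := by
        rw [eq_inv_iff_mul_eq_one, ← hX3]; simp only [pow_succ, pow_zero, one_mul]
      set d := X⁻¹ * c * X with hd
      have hd2 : d ^ 2 = 1 := by
        calc d ^ 2 = X⁻¹ * (c * c) * X := by rw [hd, pow_two]; group
          _ = 1 := by rw [hcc]; group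
      have hd1 : d ≠ 1 := by
        intro h
        apply hc
        calc c = X * (X⁻¹ * c * X) * X⁻¹ := by group
          _ = 1 := by rw [← hd, h]; group
      have hcd : c * d = X * c * X⁻¹ := by
        calc c * d = c * (X⁻¹ * c * X⁻¹) * (X * X) := by rw [hd]; group
          _ = (c * c) * X * c * (X * X) := by rw [hVcV]; group
          _ = _ := by rw [hcc, hXX, one_mul]
      have hcd2 : (c * d) * (c * d) = 1 := by
        rw [hcd]
        calc X * c * X⁻¹ * (X * c * X⁻¹) = X * (c * c) * X⁻¹ := by group
          _ = 1 := by rw [hcc]; group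
      have hcomm : c * d = d * c := by
        have hdi : d⁻¹ = d := inv_eq_of_mul_eq_one_left (by rw [← pow_two, hd2])
        calc c * d = (c * d)⁻¹ := eq_inv_of_mul_eq_one_left hcd2
          _ = d * c := by rw [mul_inv_rev, hdi, hci]
      have hfin := involution_unique hG hc hc2 hd1 hd2 hcomm
      refine not_comm hG hc hc2 hX hX3 ?_
      calc c * X = X * (X⁻¹ * c * X) := by group
        _ = X * c := by rw [← hd, ← hfin]
  · -- `t * X` has order dividing 9
    exfalso
    obtain ⟨b, hbdef⟩ : ∃ b, b = t ^ 2 * X := ⟨_, rfl⟩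
    have hb2 : b ^ 2 = 1 := by
      calc b ^ 2 = (t ^ 2 * X) * (t ^ 2 * X) := by rw [pow_two, hbdef]
        _ = X⁻¹ * (t ^ 2) ^ 2 * X := by nth_rw 1 [hzX]; group
        _ = 1 := by rw [hz2]; group
    have hbb : b * b = 1 := by rw [← pow_two, hb2]
    have hb1 : b ≠ 1 := by
      intro h
      have : X = (t ^ 2)⁻¹ := eq_inv_of_mul_eq_one_right (hbdef.symm.trans h)
      refine not_comm hG hz hz2 hX hX3 ?_
      rw [this]; group
    have htb : t⁻¹ * b = t * X := by rw [hbdef]; group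
    have hbt9 : (b * t⁻¹) ^ 9 = 1 := by
      have : b * t⁻¹ = t * (t⁻¹ * b) * t⁻¹ := by group
      rw [this, conj_pow, htb, h9]; group
    have hb1' : t⁻¹ * b * t ≠ 1 := by
      intro h
      apply hb1
      calc b = t * (t⁻¹ * b * t) * t⁻¹ := by group
        _ = 1 := by rw [h]; group
    have hb2' : (t⁻¹ * b * t) ^ 2 = 1 := by
      calc (t⁻¹ * b * t) ^ 2 = t⁻¹ * (b * b) * t := by rw [pow_two]; group
        _ = 1 := by rw [hbb]; group
    have hcomm9 := inv_mul_inv hG hb1 hb2 hb1' hb2'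
    have hzb : (t⁻¹ * t⁻¹ * b) ^ 3 = 1 := by
      have : t⁻¹ * t⁻¹ * b = X := by rw [hbdef]; group
      rw [this, hX3]
    have hit : ∀ (u : G) (n : ℕ) (w : G ⧸ Subgroup.zpowers t), (fun v => u • v)^[n] w = u ^ n • w := by
      intro u n w
      exact smul_iterate_apply u n w
    have hfix := collapse (Ω := G ⧸ Subgroup.zpowers t) (fun w => t⁻¹ • w) (fun w => t • w)
      (fun w => b • w) ((1 : G) : G ⧸ Subgroup.zpowers t)
      (fun w => by simp) (fun w => by simp)
      (fun w => by
        simp only [smul_smul]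
        have : t⁻¹ * (t⁻¹ * (t⁻¹ * t⁻¹)) = (t ^ 4)⁻¹ := by group
        rw [this, ht4, inv_one, one_smul])
      (fun w => by simp only [smul_smul, hbb, one_smul])
      (fun w => by
        simp only [smul_smul]
        have : t⁻¹ * (t⁻¹ * (b * (t⁻¹ * (t⁻¹ * (b * (t⁻¹ * (t⁻¹ * b)))))))
          = (t⁻¹ * t⁻¹ * b) ^ 3 := by simp only [pow_succ, pow_zero, one_mul, mul_assoc]
        rw [this, hzb, one_smul])
      (fun w => by
        simp only [smul_smul]
        rw [hit, hbt9, one_smul])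
      (fun w => by
        simp only [smul_smul]
        rw [hit]
        have : b * (t⁻¹ * (b * t)) = b * (t⁻¹ * b * t) := by group
        rw [this, hcomm9, one_smul])
      (by
        show ((t⁻¹ * 1 : G) : G ⧸ Subgroup.zpowers t) = _
        rw [QuotientGroup.eq]
        simp)
    have hmem : b ∈ Subgroup.zpowers t := by
      have h : ((b * 1 : G) : G ⧸ Subgroup.zpowers t) = ((1 : G) : G ⧸ Subgroup.zpowers t) := hfix
      rw [QuotientGroup.eq] at h
      simpa using h
    obtain ⟨k, hk⟩ := hmem
    have hcb : t ^ 2 * b = b * t ^ 2 := by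
      rw [← hk]
      exact ((Commute.refl t).pow_left 2).zpow_right k
    refine not_comm hG hz hz2 hX hX3 ?_
    have : X = (t ^ 2)⁻¹ * b := by rw [hbdef]; group
    calc t ^ 2 * X = b := hbdef.symm
      _ = (t ^ 2)⁻¹ * (t ^ 2 * b) := by group
      _ = X * t ^ 2 := by rw [hcb, this]; group

theorem order_nine_comm (hG : HypHStar G)
    {t x : G} (ht : orderOf t = 4) (hx : orderOf x = 9)
    (hconj : t ^ 2 * x * (t ^ 2)⁻¹ = x⁻¹) : Commute x (t * x * t⁻¹) := by
  have ht4 : t ^ 4 = 1 := by rw [← ht, pow_orderOf_eq_one]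
  have hz : t ^ 2 ≠ 1 := pow_ne_one_of_lt_orderOf (by norm_num) (by omega)
  have hz2 : (t ^ 2) ^ 2 = 1 := by rw [← pow_mul, ht4]
  have hX : x ^ 3 ≠ 1 := pow_ne_one_of_lt_orderOf (by norm_num) (by omega)
  have hx9 : x ^ 9 = 1 := by rw [← hx, pow_orderOf_eq_one]
  have hX3 : (x ^ 3) ^ 3 = 1 := by rw [← pow_mul]; exact hx9
  have hi : t ^ 2 * x ^ 3 * (t ^ 2)⁻¹ = (x ^ 3)⁻¹ := by rw [← conj_pow, hconj, inv_pow]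
  have hXY := order_three hG ht hX hX3 hi
  have hY : t * x ^ 3 * t⁻¹ ≠ 1 := by
    intro h
    apply hX
    calc x ^ 3 = t⁻¹ * (t * x ^ 3 * t⁻¹) * t := by group
      _ = 1 := by rw [h]; group
  have hY3 : (t * x ^ 3 * t⁻¹) ^ 3 = 1 := by rw [conj_pow, hX3]; group
  have hiY : t ^ 2 * (t * x ^ 3 * t⁻¹) * (t ^ 2)⁻¹ = (t * x ^ 3 * t⁻¹)⁻¹ := by
    calc t ^ 2 * (t * x ^ 3 * t⁻¹) * (t ^ 2)⁻¹ = t * (t ^ 2 * x ^ 3 * (t ^ 2)⁻¹) * t⁻¹ := by group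
      _ = _ := by rw [hi]; group
  have h1 : Commute x (t * x ^ 3 * t⁻¹) :=
    centralizer_comm hG hz hz2 hX hX3 hi ((Commute.refl x).pow_right 3) hXY.symm
  refine centralizer_comm hG hz hz2 hY hY3 hiY h1 ?_
  rw [← conj_pow]
  exact (Commute.refl _).pow_right 3

end aux

/-- Lemma 4: in a group satisfying (H*), if `t` has order 4 and `x` has order 9 with
`t² x t⁻² = x⁻¹`, then `x` commutes with `x^t` and `⟨t, x⟩` is a Frobenius group, the
semidirect product of the abelian group `P = ⟨x, x^t⟩` of exponent dividing 9 by `⟨t⟩`,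
with `⟨t⟩` acting freely on `P`. -/
theorem statement_8 (G : Type*) [Group G] (hG : HypHStar G)
    (t x : G) (ht : orderOf t = 4) (hx : orderOf x = 9)
    (hconj : t ^ 2 * x * (t ^ 2)⁻¹ = x⁻¹) :
    x * (t * x * t⁻¹) = (t * x * t⁻¹) * x ∧
    (∀ p ∈ Subgroup.closure {x, t * x * t⁻¹}, ∀ q ∈ Subgroup.closure {x, t * x * t⁻¹},
      p * q = q * p) ∧
    (∀ p ∈ Subgroup.closure {x, t * x * t⁻¹}, p ^ 9 = 1) ∧
    ((Subgroup.closure {x, t * x * t⁻¹}).subgroupOf (Subgroup.closure {t, x})).Normal ∧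
    Subgroup.closure {x, t * x * t⁻¹} ⊓ Subgroup.zpowers t = ⊥ ∧
    Subgroup.closure {x, t * x * t⁻¹} ⊔ Subgroup.zpowers t = Subgroup.closure {t, x} ∧
    (∀ p ∈ Subgroup.closure {x, t * x * t⁻¹}, p ≠ 1 →
      ∀ k : ℕ, 1 ≤ k → k ≤ 3 → t ^ k * p * (t ^ k)⁻¹ ≠ p) := by
  have ht4 : t ^ 4 = 1 := by rw [← ht, pow_orderOf_eq_one]
  have hx9 : x ^ 9 = 1 := by rw [← hx, pow_orderOf_eq_one]
  have hcomm := order_nine_comm hG ht hx hconj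
  set y := t * x * t⁻¹ with hy
  have hy9 : y ^ 9 = 1 := by rw [hy, conj_pow, hx9]; group
  have hyconj : t ^ 2 * y * (t ^ 2)⁻¹ = y⁻¹ := by
    calc t ^ 2 * y * (t ^ 2)⁻¹ = t * (t ^ 2 * x * (t ^ 2)⁻¹) * t⁻¹ := by rw [hy]; group
      _ = _ := by rw [hconj, hy]; group
  have hty : t * y * t⁻¹ = x⁻¹ := by
    rw [← hconj, hy]
    simp only [pow_two, mul_inv_rev, mul_assoc]
  have hab : ∀ p ∈ Subgroup.closure {x, y}, ∀ q ∈ Subgroup.closure {x, y}, p * q = q * p := by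
    intro p hp q hq
    have hcl : ∀ u ∈ ({x, y} : Set G), ∀ v ∈ ({x, y} : Set G), u * v = v * u := by
      rintro u (rfl | rfl) v (rfl | rfl)
      · rfl
      · exact hcomm
      · exact hcomm.symm
      · rfl
    letI := Subgroup.closureCommGroupOfComm hcl
    exact congrArg Subtype.val (mul_comm (⟨p, hp⟩ : Subgroup.closure {x, y}) ⟨q, hq⟩)
  have hp9 : ∀ p ∈ Subgroup.closure {x, y}, p ^ 9 = 1 := by
    intro p hp
    induction hp using Subgroup.closure_induction with
    | mem u hu =>
      rcases hu with rfl | rfl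
      · exact hx9
      · exact hy9
    | one => exact one_pow 9
    | mul u v hu hv h1 h2 =>
      rw [(show Commute u v from hab u hu v hv).mul_pow, h1, h2, one_mul]
    | inv u hu h1 => rw [inv_pow, h1, inv_one]
  have hinv : ∀ p ∈ Subgroup.closure {x, y}, t ^ 2 * p * (t ^ 2)⁻¹ = p⁻¹ := by
    intro p hp
    induction hp using Subgroup.closure_induction with
    | mem u hu =>
      rcases hu with rfl | rfl
      · exact hconj
      · exact hyconj
    | one => group
    | mul u v hu hv h1 h2 =>
      calc t ^ 2 * (u * v) * (t ^ 2)⁻¹ = (t ^ 2 * u * (t ^ 2)⁻¹) * (t ^ 2 * v * (t ^ 2)⁻¹) := by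
            group
        _ = (v * u)⁻¹ := by rw [h1, h2, mul_inv_rev]
        _ = _ := by rw [hab v hv u hu]
    | inv u hu h1 =>
      calc t ^ 2 * u⁻¹ * (t ^ 2)⁻¹ = (t ^ 2 * u * (t ^ 2)⁻¹)⁻¹ := by group
        _ = _ := by rw [h1]
  have hxP : x ∈ Subgroup.closure {x, y} := Subgroup.subset_closure (by simp)
  have hyP : y ∈ Subgroup.closure {x, y} := Subgroup.subset_closure (by simp)
  have htP : ∀ p ∈ Subgroup.closure {x, y}, t * p * t⁻¹ ∈ Subgroup.closure {x, y} := by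
    intro p hp
    induction hp using Subgroup.closure_induction with
    | mem u hu =>
      rcases hu with rfl | rfl
      · exact hyP
      · rw [hty]; exact inv_mem hxP
    | one => simp
    | mul u v hu hv h1 h2 =>
      have : t * (u * v) * t⁻¹ = (t * u * t⁻¹) * (t * v * t⁻¹) := by group
      rw [this]; exact mul_mem h1 h2
    | inv u hu h1 =>
      have : t * u⁻¹ * t⁻¹ = (t * u * t⁻¹)⁻¹ := by group
      rw [this]; exact inv_mem h1
  have htP' : ∀ p ∈ Subgroup.closure {x, y}, t⁻¹ * p * t ∈ Subgroup.closure {x, y} := by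
    intro p hp
    have h := htP _ (htP _ (htP _ hp))
    have e : t * (t * (t * p * t⁻¹) * t⁻¹) * t⁻¹ = t⁻¹ * p * t := by
      calc t * (t * (t * p * t⁻¹) * t⁻¹) * t⁻¹ = t⁻¹ * t ^ 4 * p * (t ^ 4)⁻¹ * t := by
            simp only [pow_succ, pow_zero, one_mul, mul_inv_rev, mul_assoc, inv_mul_cancel_left,
              inv_mul_cancel, mul_one]
        _ = _ := by rw [ht4]; group
    rwa [e] at h
  have htH : t ∈ Subgroup.closure {t, x} := Subgroup.subset_closure (by simp)
  have hxH : x ∈ Subgroup.closure {t, x} := Subgroup.subset_closure (by simp)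
  have hPH : Subgroup.closure {x, y} ≤ Subgroup.closure {t, x} := by
    rw [Subgroup.closure_le]
    rintro u (rfl | rfl)
    · exact hxH
    · exact mul_mem (mul_mem htH hxH) (inv_mem htH)
  have hnorm : ∀ h ∈ Subgroup.closure {t, x}, ∀ p ∈ Subgroup.closure {x, y},
      h * p * h⁻¹ ∈ Subgroup.closure {x, y} ∧ h⁻¹ * p * h ∈ Subgroup.closure {x, y} := by
    intro h hh
    induction hh using Subgroup.closure_induction with
    | mem u hu =>
      rcases hu with rfl | rfl
      · exact fun p hp => ⟨htP p hp, htP' p hp⟩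
      · exact fun p hp => ⟨mul_mem (mul_mem hxP hp) (inv_mem hxP),
          mul_mem (mul_mem (inv_mem hxP) hp) hxP⟩
    | one => intro p hp; simpa using hp
    | mul u v hu hv h1 h2 =>
      intro p hp
      constructor
      · have : u * v * p * (u * v)⁻¹ = u * (v * p * v⁻¹) * u⁻¹ := by group
        rw [this]; exact (h1 _ (h2 _ hp).1).1
      · have : (u * v)⁻¹ * p * (u * v) = v⁻¹ * (u⁻¹ * p * u) * v := by group
        rw [this]; exact (h2 _ (h1 _ hp).2).2
    | inv u hu h1 =>
      intro p hp
      rw [inv_inv]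
      exact ⟨(h1 p hp).2, (h1 p hp).1⟩
  refine ⟨hcomm, hab, hp9, ?_, ?_, ?_, ?_⟩
  · constructor
    intro p hp h
    rw [Subgroup.mem_subgroupOf] at hp ⊢
    exact (hnorm h h.2 p hp).1
  · rw [eq_bot_iff]
    rintro p ⟨hp, hpt⟩
    obtain ⟨k, rfl⟩ := hpt
    have h9 := hp9 _ hp
    have h4 : (t ^ k) ^ 4 = 1 := by
      rw [← zpow_natCast, ← zpow_mul, mul_comm, zpow_mul]
      norm_cast
      rw [ht4, one_zpow]
    rw [Subgroup.mem_bot]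
    calc t ^ k = (t ^ k) ^ 9 * (((t ^ k) ^ 4) ^ 2)⁻¹ := by group
      _ = 1 := by rw [h9, h4]; group
  · apply le_antisymm
    · refine sup_le hPH ?_
      rw [Subgroup.zpowers_le]
      exact htH
    · rw [Subgroup.closure_le]
      rintro u (rfl | rfl)
      · exact (le_sup_right : Subgroup.zpowers u ≤ _) (Subgroup.mem_zpowers u)
      · exact (le_sup_left : Subgroup.closure {u, y} ≤ _) hxP
  · intro p hp hp1 k hk1 hk3 hk
    apply hp1
    have hz : t ^ 2 * p * (t ^ 2)⁻¹ = p := by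
      have hc : Commute (t ^ k) p := mul_inv_eq_iff_eq_mul.1 hk
      have hc2 : Commute (t ^ 2) p := by
        interval_cases k
        · rw [pow_one] at hc; exact hc.pow_left 2
        · exact hc
        · have h6 := hc.pow_left 2
          have : (t ^ 3) ^ 2 = t ^ 2 := by
            calc (t ^ 3) ^ 2 = t ^ 4 * t ^ 2 := by rw [← pow_mul, ← pow_add]
              _ = t ^ 2 := by rw [ht4, one_mul]
          rwa [this] at h6
      exact mul_inv_eq_iff_eq_mul.2 hc2
    have h2 : p * p = 1 := by
      have := hinv p hp
      rw [hz] at this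
      exact mul_eq_one_iff_eq_inv.2 this
    have h9 := hp9 p hp
    calc p = p ^ 9 * ((p * p) ^ 4)⁻¹ := by rw [← pow_two]; group
      _ = 1 := by rw [h9, h2]; group
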